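/- Suppose f(z|τ) is an entire function of the complex variable z that is even in z and satisfies the functional equations f(z|τ) = f(z+π|τ) and f(z|τ) = q⁴ e^{16iz} f(z+πτ|τ) for all z ∈ ℂ. Then for all x, y ∈ ℂ such that θ₁(2x|τ), θ₁(2y|τ), θ₁(x|τ), θ₁(y|τ), θ₂(x|τ), θ₂(y|τ), θ₃(x|τ), θ₃(y|τ), θ₄(x|τ), θ₄(y|τ) are all nonzero, one has 4f(x|τ)/θ₁(2x|τ)² − 4f(y|τ)/θ₁(2y|τ)² = θ₁(x+y|τ)θ₁(x−y|τ)·[ −f(0|τ)/(θ₁(x|τ)²θ₁(y|τ)²) + f(π/2|τ)/(θ₂(x|τ)²θ₂(y|τ)²) − q·f((π+πτ)/2|τ)/(θ₃(x|τ)²θ₃(y|τ)²) + q·f(πτ/2|τ)/(θ₄(x|τ)²θ₄(y|τ)²) ]. -/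

import Mathlib

noncomputable section

open Complex

namespace Liu

/-- `π` as a complex number. -/
def piC : ℂ := Real.pi

/-- The nome `q = exp(2πiτ)`. -/
def qq (τ : ℂ) : ℂ := exp (2 * piC * I * τ)

/-- Jacobi theta function θ₁(z|τ). -/
def theta1 (z τ : ℂ) : ℂ :=
  -I * exp (piC * I * τ / 4) *
    ∑' n : ℤ, (-1 : ℂ) ^ n * exp (piC * I * τ * (n : ℂ) * ((n : ℂ) + 1)) *
      exp ((2 * (n : ℂ) + 1) * I * z)

/-- Jacobi theta function θ₂(z|τ). -/
def theta2 (z τ : ℂ) : ℂ :=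
  2 * ∑' n : ℕ, exp (piC * I * τ * (2 * (n : ℂ) + 1) ^ 2 / 4) * cos ((2 * (n : ℂ) + 1) * z)

/-- Jacobi theta function θ₃(z|τ). -/
def theta3 (z τ : ℂ) : ℂ :=
  1 + 2 * ∑' n : ℕ, exp (piC * I * τ * ((n : ℂ) + 1) ^ 2) * cos (2 * ((n : ℂ) + 1) * z)

/-- Jacobi theta function θ₄(z|τ). -/
def theta4 (z τ : ℂ) : ℂ :=
  1 + 2 * ∑' n : ℕ, (-1 : ℂ) ^ (n + 1) * exp (piC * I * τ * ((n : ℂ) + 1) ^ 2) *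
    cos (2 * ((n : ℂ) + 1) * z)

/-- θ₁'(τ) = (∂θ₁/∂z)(0|τ). -/
def theta1' (τ : ℂ) : ℂ := deriv (fun z => theta1 z τ) 0

/-- The Dedekind eta function. -/
def eta (τ : ℂ) : ℂ := exp (piC * I * τ / 12) * ∏' n : ℕ, (1 - qq τ ^ (n + 1))

/-- Eisenstein series L = E₂. -/
def EisL (τ : ℂ) : ℂ :=
  1 - 24 * ∑' n : ℕ, ((n : ℂ) + 1) * qq τ ^ (n + 1) / (1 - qq τ ^ (n + 1))

/-- Eisenstein series M = E₄. -/
def EisM (τ : ℂ) : ℂ :=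
  1 + 240 * ∑' n : ℕ, ((n : ℂ) + 1) ^ 3 * qq τ ^ (n + 1) / (1 - qq τ ^ (n + 1))

/-- The period lattice Λ = {mπ + nπτ : m, n ∈ ℤ}. -/
def Lambda (τ : ℂ) : Set ℂ := {z | ∃ m n : ℤ, z = (m : ℂ) * piC + (n : ℂ) * piC * τ}

/-- The Weierstrass ℘ function attached to the lattice with periods π and πτ. -/
def wp (τ z : ℂ) : ℂ :=
  1 / z ^ 2 + ∑' p : ℤ × ℤ,
    if p = (0, 0) then 0
    else 1 / (z - ((p.1 : ℂ) * piC + (p.2 : ℂ) * piC * τ)) ^ 2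
      - 1 / ((p.1 : ℂ) * piC + (p.2 : ℂ) * piC * τ) ^ 2

/-! ### The theta functions in terms of `jacobiTheta₂` -/

lemma piC_ne_zero : piC ≠ 0 := ofReal_ne_zero.mpr Real.pi_ne_zero

lemma exp_piC_mul_I : exp (piC * I) = -1 := exp_pi_mul_I

lemma exp_piC_div_two_mul_I : exp (piC / 2 * I) = I := exp_pi_div_two_mul_I

lemma theta1_eq_jacobiTheta₂ (z τ : ℂ) :
    theta1 z τ = -I * exp (piC * I * τ / 4 + I * z) *
      jacobiTheta₂ (z / piC + 1 / 2 + τ / 2) τ := by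
  rw [theta1, jacobiTheta₂, exp_add, ← mul_assoc, mul_assoc _ (exp (I * z))]
  congr 1
  rw [← _root_.tsum_mul_left]
  refine tsum_congr fun n ↦ ?_
  rw [jacobiTheta₂_term, ← exp_piC_mul_I, ← exp_int_mul, ← exp_add, ← exp_add, ← exp_add]
  congr 1
  change _ = _ + (2 * piC * I * n * _ + piC * I * n ^ 2 * τ)
  field_simp [piC_ne_zero]
  ring

lemma theta2_eq_jacobiTheta₂ (z : ℂ) {τ : ℂ} (hτ : 0 < τ.im) :
    theta2 z τ = exp (piC * I * τ / 4 + I * z) * jacobiTheta₂ (z / piC + τ / 2) τ := by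
  have h := (hasSum_jacobiTheta₂_term (z / piC + τ / 2) hτ).summable
  rw [theta2, jacobiTheta₂, ← tsum_nat_add_neg_add_one h, ← _root_.tsum_mul_left,
    ← _root_.tsum_mul_left]
  refine tsum_congr fun n ↦ ?_
  rw [jacobiTheta₂_term, jacobiTheta₂_term, cos, mul_add, ← exp_add, ← exp_add]
  have key (a b c : ℂ) : 2 * (exp a * ((exp b + exp c) / 2)) = exp (a + b) + exp (a + c) := by
    rw [exp_add, exp_add]; ring
  rw [key, ← piC]
  congr 2 <;>
  · push_cast
    field_simp [piC_ne_zero]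
    ring

lemma jacobiTheta₂_eq_one_add_tsum_nat (z : ℂ) {τ : ℂ} (hτ : 0 < τ.im) :
    jacobiTheta₂ z τ = 1 + 2 * ∑' n : ℕ, exp (piC * I * τ * ((n : ℂ) + 1) ^ 2) *
      cos (2 * ((n : ℂ) + 1) * (piC * z)) := by
  have h := (hasSum_jacobiTheta₂_term z hτ).summable
  have h₁ : Summable fun n : ℕ ↦ jacobiTheta₂_term n z τ := h.comp_injective Nat.cast_injective
  have h₂ : Summable fun n : ℕ ↦ jacobiTheta₂_term (n + 1 : ℕ) z τ :=
    (summable_nat_add_iff 1).mpr h₁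
  have h₃ : Summable fun n : ℕ ↦ jacobiTheta₂_term (-(n + 1)) z τ :=
    h.comp_injective (i := fun n : ℕ ↦ -((n : ℤ) + 1)) fun a b hab ↦ by simpa using hab
  rw [jacobiTheta₂, tsum_of_nat_of_neg_add_one (f := (jacobiTheta₂_term · z τ)) h₁ h₃,
    h₁.tsum_eq_zero_add, add_assoc,
    ← h₂.tsum_add h₃, ← _root_.tsum_mul_left]
  have h₀ : jacobiTheta₂_term ((0 : ℕ) : ℤ) z τ = 1 := by simp [jacobiTheta₂_term]
  rw [h₀]
  congr 1
  refine tsum_congr fun n ↦ ?_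
  rw [jacobiTheta₂_term, jacobiTheta₂_term, cos]
  have key (a b c : ℂ) : 2 * (exp a * ((exp b + exp c) / 2)) = exp (b + a) + exp (c + a) := by
    rw [exp_add, exp_add]; ring
  rw [key, ← piC]
  congr 2 <;>
  · push_cast
    ring

lemma theta3_eq_jacobiTheta₂ (z : ℂ) {τ : ℂ} (hτ : 0 < τ.im) :
    theta3 z τ = jacobiTheta₂ (z / piC) τ := by
  rw [jacobiTheta₂_eq_one_add_tsum_nat _ hτ, mul_div_cancel₀ _ piC_ne_zero, theta3]

lemma theta4_eq_jacobiTheta₂ (z : ℂ) {τ : ℂ} (hτ : 0 < τ.im) :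
    theta4 z τ = jacobiTheta₂ (z / piC + 1 / 2) τ := by
  rw [jacobiTheta₂_eq_one_add_tsum_nat _ hτ, theta4]
  congr 2
  refine tsum_congr fun n ↦ ?_
  have : 2 * ((n : ℂ) + 1) * (piC * (z / piC + 1 / 2)) =
      2 * ((n : ℂ) + 1) * z + ((n + 1 : ℕ) : ℂ) * Real.pi := by
    change _ = _ + _ * piC
    push_cast
    field_simp [piC_ne_zero]
  rw [this, cos_antiperiodic.add_nat_mul_eq]
  ring

/-! ### Parity and shifts by half periods -/

lemma theta3_neg (z τ : ℂ) : theta3 (-z) τ = theta3 z τ := by simp [theta3]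

lemma theta4_neg (z τ : ℂ) : theta4 (-z) τ = theta4 z τ := by simp [theta4]

lemma theta2_neg (z τ : ℂ) : theta2 (-z) τ = theta2 z τ := by simp [theta2]

lemma theta3_add_half (z : ℂ) {τ : ℂ} (hτ : 0 < τ.im) :
    theta3 (z + piC / 2) τ = theta4 z τ := by
  rw [theta3_eq_jacobiTheta₂ _ hτ, theta4_eq_jacobiTheta₂ _ hτ]
  congr 1
  field_simp [piC_ne_zero]

lemma theta4_add_half (z : ℂ) {τ : ℂ} (hτ : 0 < τ.im) :
    theta4 (z + piC / 2) τ = theta3 z τ := by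
  rw [theta3_eq_jacobiTheta₂ _ hτ, theta4_eq_jacobiTheta₂ _ hτ, ← jacobiTheta₂_add_left (z / piC)]
  congr 1
  field_simp [piC_ne_zero]
  ring

lemma theta1_add_half (z : ℂ) {τ : ℂ} (hτ : 0 < τ.im) :
    theta1 (z + piC / 2) τ = theta2 z τ := by
  rw [theta1_eq_jacobiTheta₂, theta2_eq_jacobiTheta₂ _ hτ,
    ← jacobiTheta₂_add_left (z / piC + τ / 2),
    show piC * I * τ / 4 + I * (z + piC / 2) = piC * I * τ / 4 + I * z + piC / 2 * I by ring,
    exp_add _ (piC / 2 * I), exp_piC_div_two_mul_I,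
    show (z + piC / 2) / piC + 1 / 2 + τ / 2 = z / piC + τ / 2 + 1 by
      field_simp [piC_ne_zero]; ring]
  linear_combination (-exp (piC * I * τ / 4 + I * z) *
    jacobiTheta₂ (z / piC + τ / 2 + 1) τ) * I_mul_I

lemma theta2_add_half (z : ℂ) {τ : ℂ} (hτ : 0 < τ.im) :
    theta2 (z + piC / 2) τ = -theta1 z τ := by
  rw [theta1_eq_jacobiTheta₂, theta2_eq_jacobiTheta₂ _ hτ,
    show piC * I * τ / 4 + I * (z + piC / 2) = piC * I * τ / 4 + I * z + piC / 2 * I by ring,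
    exp_add _ (piC / 2 * I), exp_piC_div_two_mul_I,
    show (z + piC / 2) / piC + τ / 2 = z / piC + 1 / 2 + τ / 2 by
      field_simp [piC_ne_zero]]
  ring

/-- The factor `q^{-1/8} e^{-iz}` by which the theta functions change under `z ↦ z + πτ/2`. -/
def halfShiftFactor (z τ : ℂ) : ℂ := exp (-(piC * I * τ / 4 + I * z))

lemma theta3_add_half_tau (z : ℂ) {τ : ℂ} (hτ : 0 < τ.im) :
    theta3 (z + piC * τ / 2) τ = halfShiftFactor z τ * theta2 z τ := by
  rw [theta3_eq_jacobiTheta₂ _ hτ, theta2_eq_jacobiTheta₂ _ hτ, halfShiftFactor, ← mul_assoc,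
    ← exp_add, neg_add_cancel, exp_zero, one_mul]
  congr 1
  field_simp [piC_ne_zero]

lemma theta4_add_half_tau (z : ℂ) {τ : ℂ} (hτ : 0 < τ.im) :
    theta4 (z + piC * τ / 2) τ = I * halfShiftFactor z τ * theta1 z τ := by
  rw [theta4_eq_jacobiTheta₂ _ hτ, theta1_eq_jacobiTheta₂, halfShiftFactor]
  have h : exp (-(piC * I * τ / 4 + I * z)) * exp (piC * I * τ / 4 + I * z) = 1 := by
    rw [← exp_add, neg_add_cancel, exp_zero]
  rw [show (z + piC * τ / 2) / piC + 1 / 2 = z / piC + 1 / 2 + τ / 2 by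
      field_simp [piC_ne_zero]; ring]
  linear_combination (jacobiTheta₂ (z / piC + 1 / 2 + τ / 2) τ) *
    (-h + exp (-(piC * I * τ / 4 + I * z)) * exp (piC * I * τ / 4 + I * z) * I_mul_I)

lemma theta2_add_half_tau (z : ℂ) {τ : ℂ} (hτ : 0 < τ.im) :
    theta2 (z + piC * τ / 2) τ = halfShiftFactor z τ * theta3 z τ := by
  rw [theta3_eq_jacobiTheta₂ _ hτ, theta2_eq_jacobiTheta₂ _ hτ, halfShiftFactor,
    show (z + piC * τ / 2) / piC + τ / 2 = z / piC + τ by field_simp [piC_ne_zero]; ring,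
    jacobiTheta₂_add_left', ← mul_assoc, ← exp_add]
  congr 2
  change _ + -piC * _ * _ = _
  field_simp [piC_ne_zero]
  ring

lemma theta1_add_half_tau (z : ℂ) {τ : ℂ} (hτ : 0 < τ.im) :
    theta1 (z + piC * τ / 2) τ = I * halfShiftFactor z τ * theta4 z τ := by
  rw [theta4_eq_jacobiTheta₂ _ hτ, theta1_eq_jacobiTheta₂, halfShiftFactor,
    show (z + piC * τ / 2) / piC + 1 / 2 + τ / 2 = z / piC + 1 / 2 + τ by
      field_simp [piC_ne_zero]; ring,
    jacobiTheta₂_add_left', ← mul_assoc, mul_assoc (-I), ← exp_add,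
    show piC * I * τ / 4 + I * (z + piC * τ / 2) + -Real.pi * I * (τ + 2 * (z / piC + 1 / 2)) =
      -(piC * I * τ / 4 + I * z) - piC * I by
        change _ + -piC * _ * _ = _
        field_simp [piC_ne_zero]
        ring,
    exp_sub, exp_piC_mul_I]
  ring

lemma theta1_add_pi (z : ℂ) {τ : ℂ} (hτ : 0 < τ.im) : theta1 (z + piC) τ = -theta1 z τ := by
  rw [show z + piC = z + piC / 2 + piC / 2 by ring, theta1_add_half _ hτ, theta2_add_half _ hτ]

lemma theta2_add_pi (z : ℂ) {τ : ℂ} (hτ : 0 < τ.im) : theta2 (z + piC) τ = -theta2 z τ := by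
  rw [show z + piC = z + piC / 2 + piC / 2 by ring, theta2_add_half _ hτ, theta1_add_half _ hτ]

lemma theta3_add_pi (z : ℂ) {τ : ℂ} (hτ : 0 < τ.im) : theta3 (z + piC) τ = theta3 z τ := by
  rw [show z + piC = z + piC / 2 + piC / 2 by ring, theta3_add_half _ hτ, theta4_add_half _ hτ]

lemma theta4_add_pi (z : ℂ) {τ : ℂ} (hτ : 0 < τ.im) : theta4 (z + piC) τ = theta4 z τ := by
  rw [show z + piC = z + piC / 2 + piC / 2 by ring, theta4_add_half _ hτ, theta3_add_half _ hτ]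

/-- The factor `q^{-1/2} e^{-2iz}` by which the theta functions change under `z ↦ z + πτ`,
up to sign. -/
def shiftFactor (z τ : ℂ) : ℂ := exp (-(piC * I * τ + 2 * I * z))

lemma halfShiftFactor_add_mul (z τ : ℂ) :
    halfShiftFactor (z + piC * τ / 2) τ * halfShiftFactor z τ = shiftFactor z τ := by
  rw [halfShiftFactor, halfShiftFactor, shiftFactor, ← exp_add]
  ring_nf

lemma theta1_add_tau (z : ℂ) {τ : ℂ} (hτ : 0 < τ.im) :
    theta1 (z + piC * τ) τ = -shiftFactor z τ * theta1 z τ := by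
  rw [show z + piC * τ = z + piC * τ / 2 + piC * τ / 2 by ring, theta1_add_half_tau _ hτ,
    theta4_add_half_tau _ hτ, ← halfShiftFactor_add_mul]
  linear_combination halfShiftFactor (z + piC * τ / 2) τ * halfShiftFactor z τ * theta1 z τ *
    I_mul_I

lemma theta2_add_tau (z : ℂ) {τ : ℂ} (hτ : 0 < τ.im) :
    theta2 (z + piC * τ) τ = shiftFactor z τ * theta2 z τ := by
  rw [show z + piC * τ = z + piC * τ / 2 + piC * τ / 2 by ring, theta2_add_half_tau _ hτ,
    theta3_add_half_tau _ hτ, ← halfShiftFactor_add_mul, mul_assoc]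

lemma theta3_add_tau (z : ℂ) {τ : ℂ} (hτ : 0 < τ.im) :
    theta3 (z + piC * τ) τ = shiftFactor z τ * theta3 z τ := by
  rw [show z + piC * τ = z + piC * τ / 2 + piC * τ / 2 by ring, theta3_add_half_tau _ hτ,
    theta2_add_half_tau _ hτ, ← halfShiftFactor_add_mul, mul_assoc]

lemma theta4_add_tau (z : ℂ) {τ : ℂ} (hτ : 0 < τ.im) :
    theta4 (z + piC * τ) τ = -shiftFactor z τ * theta4 z τ := by
  rw [show z + piC * τ = z + piC * τ / 2 + piC * τ / 2 by ring, theta4_add_half_tau _ hτ,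
    theta1_add_half_tau _ hτ, ← halfShiftFactor_add_mul]
  linear_combination halfShiftFactor (z + piC * τ / 2) τ * halfShiftFactor z τ * theta4 z τ *
    I_mul_I

lemma theta1_neg (z : ℂ) {τ : ℂ} (hτ : 0 < τ.im) : theta1 (-z) τ = -theta1 z τ := by
  have h := theta2_add_half (-z - piC) hτ
  rw [show -z - piC + piC / 2 = -(z + piC / 2) by ring, theta2_neg, theta2_add_half _ hτ] at h
  have h' := theta1_add_pi (-z - piC) hτ
  rw [sub_add_cancel] at h'
  rw [h', ← h]

lemma theta1_zero {τ : ℂ} (hτ : 0 < τ.im) : theta1 0 τ = 0 := by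
  have h := theta1_neg 0 hτ
  rw [neg_zero] at h
  exact self_eq_neg.mp h

lemma differentiable_jacobiTheta₂_comp {τ : ℂ} (hτ : 0 < τ.im) {g : ℂ → ℂ}
    (hg : Differentiable ℂ g) : Differentiable ℂ fun z ↦ jacobiTheta₂ (g z) τ :=
  fun z ↦ (differentiableAt_jacobiTheta₂_fst (g z) hτ).comp z (hg z)

lemma differentiable_theta1 {τ : ℂ} (hτ : 0 < τ.im) : Differentiable ℂ (theta1 · τ) := by
  simp_rw [theta1_eq_jacobiTheta₂]
  exact (by fun_prop : Differentiable ℂ _).mul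
    (differentiable_jacobiTheta₂_comp hτ (by fun_prop))

lemma differentiable_theta2 {τ : ℂ} (hτ : 0 < τ.im) : Differentiable ℂ (theta2 · τ) := by
  simp_rw [← theta1_add_half _ hτ]
  exact (differentiable_theta1 hτ).comp (by fun_prop)

lemma differentiable_theta3 {τ : ℂ} (hτ : 0 < τ.im) : Differentiable ℂ (theta3 · τ) := by
  simp_rw [theta3_eq_jacobiTheta₂ _ hτ]
  exact differentiable_jacobiTheta₂_comp hτ (by fun_prop)

lemma differentiable_theta4 {τ : ℂ} (hτ : 0 < τ.im) : Differentiable ℂ (theta4 · τ) := by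
  simp_rw [← theta3_add_half _ hτ]
  exact (differentiable_theta3 hτ).comp (by fun_prop)

/-! ### Fourier coefficients of periodic entire functions -/

/-- The `n`-th Fourier coefficient, up to the factor `π`, of a `π`-periodic function. -/
def coeffPi (n : ℤ) (f : ℂ → ℂ) : ℂ :=
  ∫ t in (0 : ℝ)..Real.pi, exp (-2 * n * I * t) * f t

lemma integral_add_eq_of_periodic {g : ℂ → ℂ} (hg : Differentiable ℂ g)
    (hp : ∀ z, g (z + piC) = g z) (w : ℂ) :
    ∫ t in (0 : ℝ)..Real.pi, g (t + w) = ∫ t in (0 : ℝ)..Real.pi, g t := by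
  have hre : ∫ t in (0 : ℝ)..Real.pi, g (t + w) = ∫ t in (0 : ℝ)..Real.pi, g (t + w.im * I) := by
    have hper : Function.Periodic (fun t : ℝ ↦ g (t + w.im * I)) Real.pi := fun t ↦ by
      change g ((t + Real.pi : ℝ) + w.im * I) = g (t + w.im * I)
      rw [← hp (t + w.im * I)]
      congr 1
      simp only [piC]
      push_cast
      ring
    have h := hper.intervalIntegral_add_eq w.re 0
    have h' := intervalIntegral.integral_comp_add_right (a := 0) (b := Real.pi)
      (fun t : ℝ ↦ g (t + w.im * I)) w.re
    rw [zero_add] at h h'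
    rw [← h, add_comm w.re, ← h']
    refine intervalIntegral.integral_congr fun t _ ↦ ?_
    congr 1
    push_cast
    rw [add_assoc, re_add_im]
  have hrect := Complex.integral_boundary_rect_eq_zero_of_differentiableOn g 0
    (Real.pi + w.im * I) hg.differentiableOn
  have hside : ∀ y : ℝ, g ((Real.pi : ℂ) + y * I) = g (y * I) := fun y ↦ by
    rw [← hp (y * I), add_comm]; rfl
  simp [hside] at hrect
  rw [hre]
  exact (sub_eq_zero.mp hrect).symm

lemma differentiable_exp_mul {f : ℂ → ℂ} (hf : Differentiable ℂ f) (n : ℤ) :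
    Differentiable ℂ fun z ↦ exp (-2 * n * I * z) * f z := by fun_prop

lemma exp_mul_add_pi {f : ℂ → ℂ} (hp : ∀ z, f (z + piC) = f z) (n : ℤ) (z : ℂ) :
    exp (-2 * n * I * (z + piC)) * f (z + piC) = exp (-2 * n * I * z) * f z := by
  rw [hp, show -2 * n * I * (z + piC) = -2 * n * I * z + (-n : ℤ) * (2 * Real.pi * I) by
    simp only [piC]; push_cast; ring, exp_add, exp_int_mul_two_pi_mul_I, mul_one]

lemma coeffPi_neg {f : ℂ → ℂ} (hf : Differentiable ℂ f) (hp : ∀ z, f (z + piC) = f z)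
    (he : ∀ z, f (-z) = f z) (n : ℤ) : coeffPi (-n) f = coeffPi n f := by
  have h := integral_add_eq_of_periodic (differentiable_exp_mul hf n) (exp_mul_add_pi hp n)
    (-Real.pi)
  rw [coeffPi, coeffPi, ← h, ← neg_neg Real.pi]
  have h' := intervalIntegral.integral_comp_sub_left (a := 0) (b := Real.pi)
    (fun t : ℝ ↦ exp (-2 * n * I * (t + (-Real.pi : ℂ))) * f (t + (-Real.pi : ℂ))) Real.pi
  rw [sub_self, sub_zero] at h'
  rw [neg_neg, ← h']
  refine intervalIntegral.integral_congr fun t _ ↦ ?_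
  rw [show ((Real.pi - t : ℝ) : ℂ) + -(Real.pi : ℂ) = -t by push_cast; ring, he]
  congr 2
  push_cast
  ring

lemma coeffPi_add_eq_zero_iff {f : ℂ → ℂ} (hf : Differentiable ℂ f)
    (hp : ∀ z, f (z + piC) = f z) {τ s : ℂ} (hs : s ≠ 0) {d : ℤ}
    (hq : ∀ z, f (z + piC * τ) = s * exp (-2 * d * I * z) * f z) (n : ℤ) :
    coeffPi (n + d) f = 0 ↔ coeffPi n f = 0 := by
  have h := integral_add_eq_of_periodic (differentiable_exp_mul hf n) (exp_mul_add_pi hp n)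
    (piC * τ)
  have key : coeffPi n f = (exp (-2 * n * I * (piC * τ)) * s) * coeffPi (n + d) f := by
    rw [coeffPi, coeffPi, ← h, ← intervalIntegral.integral_const_mul]
    refine intervalIntegral.integral_congr fun t _ ↦ ?_
    rw [hq, show -2 * n * I * (t + piC * τ) = -2 * n * I * (piC * τ) + -2 * n * I * t by ring,
      show -2 * ((n + d : ℤ) : ℂ) * I * t = -2 * n * I * t + -2 * d * I * t by push_cast; ring,
      exp_add, exp_add]
    ring
  rw [key, mul_eq_zero, or_iff_right (mul_ne_zero (exp_ne_zero _) hs)]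

lemma coeffPi_eq_zero_iff_emod {f : ℂ → ℂ} (hf : Differentiable ℂ f)
    (hp : ∀ z, f (z + piC) = f z) {τ s : ℂ} (hs : s ≠ 0) {d : ℤ}
    (hq : ∀ z, f (z + piC * τ) = s * exp (-2 * d * I * z) * f z) (n : ℤ) :
    coeffPi n f = 0 ↔ coeffPi (n % d) f = 0 := by
  have key (m k : ℤ) : coeffPi (m + k * d) f = 0 ↔ coeffPi m f = 0 := by
    induction k with
    | zero => simp
    | succ k ih => rw [add_one_mul, ← add_assoc, coeffPi_add_eq_zero_iff hf hp hs hq, ih]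
    | pred k ih =>
      rw [← ih, ← coeffPi_add_eq_zero_iff hf hp hs hq (m + (-(k : ℤ) - 1) * d)]
      ring_nf
  rw [← key (n % d) (n / d), Int.emod_add_ediv_mul]

lemma eq_zero_of_coeffPi_eq_zero {f : ℂ → ℂ} (hf : Differentiable ℂ f)
    (hp : ∀ z, f (z + piC) = f z) (h : ∀ n, coeffPi n f = 0) : f = 0 := by
  have : Fact (0 < Real.pi) := ⟨Real.pi_pos⟩
  have hper : Function.Periodic (fun t : ℝ ↦ f t) Real.pi := fun t ↦ by
    simpa [piC] using hp t
  have hc : Continuous fun t : ℝ ↦ f t := hf.continuous.comp continuous_ofReal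
  let F : C(AddCircle Real.pi, ℂ) := ⟨hper.lift, continuous_coinduced_dom.mpr hc⟩
  have hF (t : ℝ) : F t = f t := rfl
  have hcoeff : fourierCoeff F = 0 := by
    ext n
    rw [fourierCoeff_eq_intervalIntegral _ _ 0, zero_add, Pi.zero_apply, smul_eq_zero]
    right
    rw [← h n, coeffPi]
    refine intervalIntegral.integral_congr fun t _ ↦ ?_
    simp only [hF, fourier_coe_apply, smul_eq_mul]
    congr 2
    have : (Real.pi : ℂ) ≠ 0 := piC_ne_zero
    push_cast
    field_simp
  have hreal (t : ℝ) : f t = 0 := by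
    have h₁ := has_pointwise_sum_fourier_series_of_summable (f := F)
      (by rw [hcoeff]; exact summable_zero) (t : AddCircle Real.pi)
    simp only [hcoeff, Pi.zero_apply, zero_smul] at h₁
    rw [← hF]
    exact h₁.unique hasSum_zero
  have han : AnalyticOnNhd ℂ f Set.univ := fun z _ ↦ hf.analyticAt z
  have hfreq : ∃ᶠ z in nhdsWithin (0 : ℂ) {0}ᶜ, f z = 0 := by
    have ht : Filter.Tendsto (fun t : ℝ ↦ (t : ℂ)) (nhdsWithin (0 : ℝ) {0}ᶜ)
        (nhdsWithin (0 : ℂ) {0}ᶜ) := by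
      refine tendsto_nhdsWithin_iff.mpr ⟨?_, ?_⟩
      · exact (continuous_ofReal.tendsto' 0 0 ofReal_zero).mono_left nhdsWithin_le_nhds
      · filter_upwards [self_mem_nhdsWithin] with t ht
        simpa using ht
    exact ht.frequently (Filter.Frequently.of_forall hreal)
  funext z
  exact han.eqOn_zero_of_preconnected_of_frequently_eq_zero isPreconnected_univ (Set.mem_univ 0)
    hfreq (Set.mem_univ z)

/-! ### Spaces of even theta functions of given degree -/

lemma shiftFactor_eq (z τ : ℂ) :
    shiftFactor z τ = exp (-(piC * I * τ)) * exp (-2 * I * z) := by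
  rw [shiftFactor, ← exp_add]
  ring_nf

lemma shiftFactor_add_mul_sub (z w τ : ℂ) :
    shiftFactor (z + w) τ * shiftFactor (z - w) τ = shiftFactor z τ ^ 2 := by
  rw [sq, shiftFactor, shiftFactor, shiftFactor, ← exp_add, ← exp_add]
  ring_nf

/-- Even entire functions of period `π` that are multiplied by `s (q^{-1/2} e^{-2iz})^d`
under `z ↦ z + πτ`. -/
def evenThetaSpace (τ s : ℂ) (d : ℕ) : Submodule ℂ (ℂ → ℂ) where
  carrier := {f | Differentiable ℂ f ∧ (∀ z, f (z + piC) = f z) ∧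
    (∀ z, f (z + piC * τ) = s * shiftFactor z τ ^ d * f z) ∧ ∀ z, f (-z) = f z}
  add_mem' := by
    rintro f g ⟨hf, hf₁, hf₂, hf₃⟩ ⟨hg, hg₁, hg₂, hg₃⟩
    exact ⟨hf.add hg, fun z ↦ by simp [hf₁, hg₁], fun z ↦ by simp [hf₂, hg₂, mul_add],
      fun z ↦ by simp [hf₃, hg₃]⟩
  zero_mem' := ⟨differentiable_const 0, by simp, by simp, by simp⟩
  smul_mem' := by
    rintro c f ⟨hf, hf₁, hf₂, hf₃⟩
    exact ⟨hf.const_smul c, fun z ↦ by simp [hf₁],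
      fun z ↦ by simp only [Pi.smul_apply, hf₂, smul_eq_mul]; ring, fun z ↦ by simp [hf₃]⟩

section evenThetaSpace

variable {τ s : ℂ} {d : ℕ} {f g : ℂ → ℂ}

lemma mul_mem_evenThetaSpace {e : ℕ} (hf : f ∈ evenThetaSpace τ 1 d)
    (hg : g ∈ evenThetaSpace τ 1 e) : f * g ∈ evenThetaSpace τ 1 (d + e) := by
  obtain ⟨hf, hf₁, hf₂, hf₃⟩ := hf
  obtain ⟨hg, hg₁, hg₂, hg₃⟩ := hg
  exact ⟨hf.mul hg, fun z ↦ by simp [hf₁, hg₁],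
    fun z ↦ by simp only [Pi.mul_apply, hf₂, hg₂]; ring, fun z ↦ by simp [hf₃, hg₃]⟩

lemma prod_mem_evenThetaSpace {ι : Type*} (S : Finset ι) {F : ι → ℂ → ℂ}
    (hF : ∀ i ∈ S, F i ∈ evenThetaSpace τ 1 d) :
    ∏ i ∈ S, F i ∈ evenThetaSpace τ 1 (S.card * d) := by
  classical
  induction S using Finset.induction_on with
  | empty => exact ⟨differentiable_const 1, by simp, by simp, by simp⟩
  | insert i S hi ih =>
    rw [Finset.prod_insert hi, Finset.card_insert_of_notMem hi, add_one_mul, add_comm]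
    exact mul_mem_evenThetaSpace (hF i (Finset.mem_insert_self i S))
      (ih fun j hj ↦ hF j (Finset.mem_insert_of_mem hj))

lemma coeffPi_emod_of_mem (hs : s ≠ 0) (hf : f ∈ evenThetaSpace τ s d) (n : ℤ) :
    coeffPi n f = 0 ↔ coeffPi (n % d) f = 0 := by
  refine coeffPi_eq_zero_iff_emod hf.1 hf.2.1 (τ := τ)
    (s := s * exp (-(piC * I * τ)) ^ d) (mul_ne_zero hs (pow_ne_zero _ (exp_ne_zero _)))
    (fun z ↦ ?_) n
  rw [hf.2.2.1, shiftFactor_eq, mul_pow, ← exp_nat_mul (-2 * I * z)]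
  push_cast
  ring_nf

lemma eq_zero_of_mem_evenThetaSpace_eight (hf : f ∈ evenThetaSpace τ 1 8)
    (h : ∀ i : Fin 5, coeffPi (i : ℕ) f = 0) : f = 0 := by
  refine eq_zero_of_coeffPi_eq_zero hf.1 hf.2.1 fun n ↦ ?_
  rw [coeffPi_emod_of_mem one_ne_zero hf]
  have h₁ : (0 : ℤ) ≤ n % (8 : ℕ) := by lia
  have h₂ : n % (8 : ℕ) < 8 := by lia
  have hneg (m : ℤ) (hm : coeffPi m f = 0) : coeffPi (8 - m) f = 0 := by
    rw [coeffPi_emod_of_mem one_ne_zero hf,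
      show (8 - m) % (8 : ℕ) = (-m) % (8 : ℕ) by lia, ← coeffPi_emod_of_mem one_ne_zero hf,
      coeffPi_neg hf.1 hf.2.1 hf.2.2.2, hm]
  have h5 := hneg 3 (h 3)
  have h6 := hneg 2 (h 2)
  have h7 := hneg 1 (h 1)
  generalize n % (8 : ℕ) = m at h₁ h₂
  interval_cases m
  exacts [h 0, h 1, h 2, h 3, h 4, h5, h6, h7]

lemma coeffPi_add (hf : Differentiable ℂ f) (hg : Differentiable ℂ g) (n : ℤ) :
    coeffPi n (f + g) = coeffPi n f + coeffPi n g := by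
  have hint {k : ℂ → ℂ} (hk : Differentiable ℂ k) : IntervalIntegrable
      (fun t : ℝ ↦ exp (-2 * n * I * t) * k t) MeasureTheory.volume 0 Real.pi :=
    ((differentiable_exp_mul hk n).continuous.comp continuous_ofReal).intervalIntegrable _ _
  rw [coeffPi, coeffPi, coeffPi, ← intervalIntegral.integral_add (hint hf) (hint hg)]
  simp only [Pi.add_apply, mul_add]

lemma coeffPi_smul (c : ℂ) (f : ℂ → ℂ) (n : ℤ) : coeffPi n (c • f) = c * coeffPi n f := by
  rw [coeffPi, coeffPi, ← intervalIntegral.integral_const_mul]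
  simp only [Pi.smul_apply, smul_eq_mul, mul_left_comm]

lemma coeffPi_sub_smul (hf : Differentiable ℂ f) (hg : Differentiable ℂ g) (a b : ℂ) (n : ℤ) :
    coeffPi n (a • f - b • g) = a * coeffPi n f - b * coeffPi n g := by
  rw [sub_eq_add_neg, ← neg_smul, coeffPi_add (hf.const_smul a) (hg.const_smul _),
    coeffPi_smul, coeffPi_smul, neg_mul, sub_eq_add_neg]

lemma eq_zero_of_mem_evenThetaSpace_two (hf : f ∈ evenThetaSpace τ (-1) 2)
    (h : coeffPi 0 f = 0) : f = 0 := by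
  have h1 : coeffPi 1 f = 0 := by
    have hint := integral_add_eq_of_periodic (differentiable_exp_mul hf.1 (-1))
      (exp_mul_add_pi hf.2.1 (-1)) (piC * τ)
    have key : coeffPi (-1) f = -coeffPi 1 f := by
      rw [coeffPi, coeffPi, ← hint, ← intervalIntegral.integral_neg]
      refine intervalIntegral.integral_congr fun t _ ↦ ?_
      rw [hf.2.2.1, shiftFactor, ← exp_nat_mul, ← mul_assoc, mul_left_comm, ← exp_add, ← neg_mul,
        neg_one_mul]
      congr 3
      push_cast
      ring
    rw [coeffPi_neg hf.1 hf.2.1 hf.2.2.2] at key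
    exact self_eq_neg.mp key
  refine eq_zero_of_coeffPi_eq_zero hf.1 hf.2.1 fun n ↦ ?_
  rw [coeffPi_emod_of_mem (neg_ne_zero.mpr one_ne_zero) hf]
  rcases Int.emod_two_eq_zero_or_one n with hn | hn
  · rwa [Nat.cast_ofNat, hn]
  · rwa [Nat.cast_ofNat, hn]

/-- The space of even theta functions of degree two with character `-1` is at most
one-dimensional. -/
lemma mul_eq_mul_of_mem_evenThetaSpace_two (hf : f ∈ evenThetaSpace τ (-1) 2)
    (hg : g ∈ evenThetaSpace τ (-1) 2) (z w : ℂ) : g w * f z = f w * g z := by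
  by_cases h : coeffPi 0 g = 0
  · simp [eq_zero_of_mem_evenThetaSpace_two hg h]
  have h0 : coeffPi 0 g • f - coeffPi 0 f • g = 0 := by
    refine eq_zero_of_mem_evenThetaSpace_two
      (sub_mem (Submodule.smul_mem _ _ hf) (Submodule.smul_mem _ _ hg)) ?_
    rw [coeffPi_sub_smul hf.1 hg.1, mul_comm, sub_self]
  have hz := congrFun h0 z
  have hw := congrFun h0 w
  simp only [Pi.sub_apply, Pi.smul_apply, smul_eq_mul, Pi.zero_apply] at hz hw
  refine mul_left_cancel₀ h ?_
  linear_combination g w * hz - g z * hw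

end evenThetaSpace

/-! ### The duplication formula -/

lemma theta1_mul_theta1_mem {τ : ℂ} (hτ : 0 < τ.im) (w : ℂ) :
    (fun z ↦ theta1 (z + w) τ * theta1 (z - w) τ) ∈ evenThetaSpace τ 1 2 := by
  have hd := differentiable_theta1 hτ
  refine ⟨(hd.comp (by fun_prop : Differentiable ℂ (· + w))).mul
    (hd.comp (by fun_prop : Differentiable ℂ (· - w))), fun z ↦ ?_, fun z ↦ ?_, fun z ↦ ?_⟩
  · beta_reduce
    rw [add_right_comm, add_sub_right_comm, theta1_add_pi _ hτ, theta1_add_pi _ hτ, neg_mul_neg]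
  · beta_reduce
    rw [add_right_comm, add_sub_right_comm, theta1_add_tau _ hτ, theta1_add_tau _ hτ,
      ← shiftFactor_add_mul_sub z w]
    ring
  · beta_reduce
    rw [show -z + w = -(z - w) by ring, show -z - w = -(z + w) by ring, theta1_neg _ hτ,
      theta1_neg _ hτ]
    ring

lemma theta1_mul_theta2_sub_mem {τ : ℂ} (hτ : 0 < τ.im) (w : ℂ) :
    (fun z ↦ theta1 (z + w) τ * theta2 (z - w) τ - theta1 (z - w) τ * theta2 (z + w) τ) ∈
      evenThetaSpace τ (-1) 2 := by
  have hp : Differentiable ℂ (· + w) := by fun_prop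
  have hm : Differentiable ℂ (· - w) := by fun_prop
  have h₁ := differentiable_theta1 hτ
  have h₂ := differentiable_theta2 hτ
  refine ⟨((h₁.comp hp).mul (h₂.comp hm)).sub ((h₁.comp hm).mul (h₂.comp hp)),
    fun z ↦ ?_, fun z ↦ ?_, fun z ↦ ?_⟩
  · simp only [add_right_comm, add_sub_right_comm, theta1_add_pi _ hτ, theta2_add_pi _ hτ,
      neg_mul_neg]
  · simp only [add_right_comm, add_sub_right_comm, theta1_add_tau _ hτ, theta2_add_tau _ hτ]
    rw [← shiftFactor_add_mul_sub z w]
    ring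
  · beta_reduce
    rw [show -z + w = -(z - w) by ring, show -z - w = -(z + w) by ring, theta1_neg _ hτ,
      theta1_neg _ hτ, theta2_neg, theta2_neg]
    ring

lemma theta3_mul_theta4_mem {τ : ℂ} (hτ : 0 < τ.im) :
    (fun z ↦ theta3 z τ * theta4 z τ) ∈ evenThetaSpace τ (-1) 2 := by
  refine ⟨(differentiable_theta3 hτ).mul (differentiable_theta4 hτ), fun z ↦ ?_, fun z ↦ ?_,
    fun z ↦ by beta_reduce; rw [theta3_neg, theta4_neg]⟩
  · beta_reduce
    rw [theta3_add_pi _ hτ, theta4_add_pi _ hτ]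
  · beta_reduce
    rw [theta3_add_tau _ hτ, theta4_add_tau _ hτ]
    ring

/-- The duplication formula for `θ₁`. -/
lemma theta1_two_mul {τ : ℂ} (hτ : 0 < τ.im) (z : ℂ) :
    theta2 0 τ * theta3 0 τ * theta4 0 τ * theta1 (2 * z) τ =
      2 * theta1 z τ * theta2 z τ * theta3 z τ * theta4 z τ := by
  have h := mul_eq_mul_of_mem_evenThetaSpace_two (theta1_mul_theta2_sub_mem hτ z)
    (theta3_mul_theta4_mem hτ) z 0
  simp only [zero_add, zero_sub, sub_self, theta1_zero hτ, theta2_neg, theta1_neg _ hτ,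
    ← two_mul] at h
  linear_combination h

/-! ### Interpolation in the space of even theta functions of degree eight -/

lemma eq_zero_of_mem_evenThetaSpace_eight_of_eval {τ : ℂ} (hτ : 0 < τ.im) (p : Fin 5 → ℂ)
    (hp : ∀ i j, i ≠ j → theta1 (p i + p j) τ * theta1 (p i - p j) τ ≠ 0) {f : ℂ → ℂ}
    (hf : f ∈ evenThetaSpace τ 1 8) (h : ∀ i, f (p i) = 0) : f = 0 := by
  let coeffs : evenThetaSpace τ 1 8 →ₗ[ℂ] (Fin 5 → ℂ) :=
    { toFun := fun g i ↦ coeffPi (i : ℕ) g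
      map_add' := fun g k ↦ funext fun i ↦ coeffPi_add g.2.1 k.2.1 _
      map_smul' := fun c g ↦ funext fun i ↦ coeffPi_smul c g _ }
  have hcoeffs : Function.Injective coeffs := (injective_iff_map_eq_zero coeffs).mpr
    fun g hg ↦ Subtype.ext (eq_zero_of_mem_evenThetaSpace_eight g.2 (congrFun hg))
  have : Module.Finite ℂ (evenThetaSpace τ 1 8) := Module.Finite.of_injective coeffs hcoeffs
  let eval : evenThetaSpace τ 1 8 →ₗ[ℂ] (Fin 5 → ℂ) :=
    LinearMap.pi fun i ↦ (LinearMap.proj (p i)).comp (Submodule.subtype _)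
  have hbasis (i : Fin 5) : ∃ g, eval g = Pi.single i 1 := by
    let F : ℂ → ℂ := ∏ j ∈ Finset.univ.erase i,
      fun z ↦ theta1 (z + p j) τ * theta1 (z - p j) τ
    have hF_apply (z : ℂ) : F z = ∏ j ∈ Finset.univ.erase i,
        theta1 (z + p j) τ * theta1 (z - p j) τ := Finset.prod_apply _ _ _
    have hF : F ∈ evenThetaSpace τ 1 8 := by
      have := prod_mem_evenThetaSpace (Finset.univ.erase i)
        fun j _ ↦ theta1_mul_theta1_mem hτ (p j)
      simpa [Finset.card_erase_of_mem] using this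
    have hFi : F (p i) ≠ 0 := by
      rw [hF_apply, Finset.prod_ne_zero_iff]
      exact fun j hj ↦ hp i j (Finset.ne_of_mem_erase hj).symm
    refine ⟨(F (p i))⁻¹ • ⟨F, hF⟩, funext fun j ↦ ?_⟩
    change (F (p i))⁻¹ * F (p j) = _
    obtain rfl | hij := eq_or_ne j i
    · rw [inv_mul_cancel₀ hFi, Pi.single_eq_same]
    · rw [Pi.single_eq_of_ne hij, hF_apply (p j),
        Finset.prod_eq_zero (Finset.mem_erase.mpr ⟨hij, Finset.mem_univ j⟩), mul_zero]
      rw [sub_self, theta1_zero hτ, mul_zero]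
  have hsurj : Function.Surjective eval := by
    rw [← LinearMap.range_eq_top, eq_top_iff, ← (Pi.basisFun ℂ (Fin 5)).span_eq,
      Submodule.span_le]
    rintro _ ⟨i, rfl⟩
    rw [Pi.basisFun_apply]
    exact hbasis i
  have hrank : Module.finrank ℂ (evenThetaSpace τ 1 8) = Module.finrank ℂ (Fin 5 → ℂ) :=
    le_antisymm (LinearMap.finrank_le_finrank_of_injective hcoeffs)
      (eval.finrank_le_finrank_of_surjective hsurj)
  have hinj : Function.Injective eval :=
    (LinearMap.injective_iff_surjective_of_finrank_eq_finrank hrank).mpr hsurj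
  have hzero : (⟨f, hf⟩ : evenThetaSpace τ 1 8) = 0 :=
    (injective_iff_map_eq_zero eval).mp hinj _ (funext h)
  exact congrArg Subtype.val hzero

/-! ### Values at the half periods -/

lemma halfShiftFactor_mul_neg (z τ : ℂ) :
    halfShiftFactor z τ * halfShiftFactor (-z) τ = halfShiftFactor 0 τ ^ 2 := by
  rw [sq, halfShiftFactor, halfShiftFactor, halfShiftFactor, ← exp_add, ← exp_add]
  ring_nf

lemma qq_mul_halfShiftFactor_pow (τ : ℂ) : qq τ * halfShiftFactor 0 τ ^ 8 = 1 := by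
  rw [qq, halfShiftFactor, ← exp_nat_mul, ← exp_add, ← exp_zero]
  push_cast
  ring_nf

lemma theta1_mul_theta1_half (z : ℂ) {τ : ℂ} (hτ : 0 < τ.im) :
    theta1 (z + piC / 2) τ * theta1 (z - piC / 2) τ = -theta2 z τ ^ 2 := by
  rw [show z - piC / 2 = -(-z + piC / 2) by ring, theta1_neg _ hτ, theta1_add_half _ hτ,
    theta1_add_half _ hτ, theta2_neg]
  ring

lemma theta1_mul_theta1_half_tau (z : ℂ) {τ : ℂ} (hτ : 0 < τ.im) :
    theta1 (z + piC * τ / 2) τ * theta1 (z - piC * τ / 2) τ =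
      halfShiftFactor 0 τ ^ 2 * theta4 z τ ^ 2 := by
  rw [show z - piC * τ / 2 = -(-z + piC * τ / 2) by ring, theta1_neg _ hτ,
    theta1_add_half_tau _ hτ, theta1_add_half_tau _ hτ, theta4_neg, ← halfShiftFactor_mul_neg z]
  linear_combination (-halfShiftFactor z τ * halfShiftFactor (-z) τ * theta4 z τ ^ 2) * I_mul_I

lemma half_add_half_tau (τ : ℂ) : (piC + piC * τ) / 2 = piC * τ / 2 + piC / 2 := by ring

lemma theta1_mul_theta1_half_add_half_tau (z : ℂ) {τ : ℂ} (hτ : 0 < τ.im) :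
    theta1 (z + (piC + piC * τ) / 2) τ * theta1 (z - (piC + piC * τ) / 2) τ =
      -(halfShiftFactor 0 τ ^ 2 * theta3 z τ ^ 2) := by
  rw [show z - (piC + piC * τ) / 2 = -(-z + (piC + piC * τ) / 2) by ring, theta1_neg _ hτ,
    half_add_half_tau, ← add_assoc, ← add_assoc, theta1_add_half _ hτ, theta1_add_half _ hτ,
    theta2_add_half_tau _ hτ, theta2_add_half_tau _ hτ, theta3_neg, ← halfShiftFactor_mul_neg z]
  ring

lemma theta1_half {τ : ℂ} (hτ : 0 < τ.im) :
    theta1 (piC / 2) τ = theta2 0 τ := by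
  simpa using theta1_add_half 0 hτ

lemma theta2_half {τ : ℂ} (hτ : 0 < τ.im) :
    theta2 (piC / 2) τ = 0 := by
  simpa [theta1_zero hτ] using theta2_add_half 0 hτ

lemma theta3_half {τ : ℂ} (hτ : 0 < τ.im) :
    theta3 (piC / 2) τ = theta4 0 τ := by
  simpa using theta3_add_half 0 hτ

lemma theta4_half {τ : ℂ} (hτ : 0 < τ.im) :
    theta4 (piC / 2) τ = theta3 0 τ := by
  simpa using theta4_add_half 0 hτ

lemma theta1_half_tau {τ : ℂ} (hτ : 0 < τ.im) :
    theta1 (piC * τ / 2) τ = I * halfShiftFactor 0 τ * theta4 0 τ := by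
  simpa using theta1_add_half_tau 0 hτ

lemma theta2_half_tau {τ : ℂ} (hτ : 0 < τ.im) :
    theta2 (piC * τ / 2) τ = halfShiftFactor 0 τ * theta3 0 τ := by
  simpa using theta2_add_half_tau 0 hτ

lemma theta3_half_tau {τ : ℂ} (hτ : 0 < τ.im) :
    theta3 (piC * τ / 2) τ = halfShiftFactor 0 τ * theta2 0 τ := by
  simpa using theta3_add_half_tau 0 hτ

lemma theta4_half_tau {τ : ℂ} (hτ : 0 < τ.im) :
    theta4 (piC * τ / 2) τ = 0 := by
  simpa [theta1_zero hτ] using theta4_add_half_tau 0 hτ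

lemma theta1_half_add_half_tau {τ : ℂ} (hτ : 0 < τ.im) :
    theta1 ((piC + piC * τ) / 2) τ = halfShiftFactor 0 τ * theta3 0 τ := by
  rw [half_add_half_tau, theta1_add_half _ hτ, theta2_half_tau hτ]

lemma theta2_half_add_half_tau {τ : ℂ} (hτ : 0 < τ.im) :
    theta2 ((piC + piC * τ) / 2) τ = -(I * halfShiftFactor 0 τ * theta4 0 τ) := by
  rw [half_add_half_tau, theta2_add_half _ hτ, theta1_half_tau hτ]

lemma theta3_half_add_half_tau {τ : ℂ} (hτ : 0 < τ.im) :
    theta3 ((piC + piC * τ) / 2) τ = 0 := by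
  rw [half_add_half_tau, theta3_add_half _ hτ, theta4_half_tau hτ]

lemma theta4_half_add_half_tau {τ : ℂ} (hτ : 0 < τ.im) :
    theta4 ((piC + piC * τ) / 2) τ = halfShiftFactor 0 τ * theta2 0 τ := by
  rw [half_add_half_tau, theta4_add_half _ hτ, theta3_half_tau hτ]

/-- The four half periods and a point at which no theta function vanishes are pairwise incongruent,
up to sign, modulo the zeros of `θ₁`. -/
lemma theta1_mul_theta1_ne_zero {τ : ℂ} (hτ : 0 < τ.im) {y : ℂ} (h₂ : theta2 0 τ ≠ 0)
    (h₃ : theta3 0 τ ≠ 0) (h₄ : theta4 0 τ ≠ 0) (hy₁ : theta1 y τ ≠ 0) (hy₂ : theta2 y τ ≠ 0)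
    (hy₃ : theta3 y τ ≠ 0) (hy₄ : theta4 y τ ≠ 0) (i j : Fin 5) (hij : i ≠ j) :
    let p : Fin 5 → ℂ := ![0, piC / 2, (piC + piC * τ) / 2, piC * τ / 2, y]
    theta1 (p i + p j) τ * theta1 (p i - p j) τ ≠ 0 := by
  intro p
  have hc : halfShiftFactor 0 τ ≠ 0 := exp_ne_zero _
  have hlt (i j : Fin 5) (h : j < i) : theta1 (p i + p j) τ * theta1 (p i - p j) τ ≠ 0 := by
    fin_cases j <;> fin_cases i <;> first
      | exact absurd h (by decide)
      | simp [p, theta1_mul_theta1_half _ hτ, theta1_mul_theta1_half_tau _ hτ,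
          theta1_mul_theta1_half_add_half_tau _ hτ, theta1_half hτ, theta1_half_tau hτ,
          theta1_half_add_half_tau hτ, theta2_half_tau hτ, theta2_half_add_half_tau hτ,
          theta3_half_tau hτ, h₂, h₃, h₄, hy₁, hy₂, hy₃, hy₄, hc]
  rcases lt_or_gt_of_ne hij with h | h
  · have := hlt j i h
    rwa [add_comm, ← neg_sub, theta1_neg _ hτ, mul_neg, neg_ne_zero] at this
  · exact hlt i j h

lemma sq_mem_evenThetaSpace {τ : ℂ} {g : ℂ → ℂ} (hg : Differentiable ℂ g)
    (h₁ : ∀ z, g (z + piC) ^ 2 = g z ^ 2)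
    (h₂ : ∀ z, g (z + piC * τ) ^ 2 = (shiftFactor z τ * g z) ^ 2)
    (h₃ : ∀ z, g (-z) ^ 2 = g z ^ 2) : (fun z ↦ g z ^ 2) ∈ evenThetaSpace τ 1 2 :=
  ⟨hg.pow 2, h₁, fun z ↦ by beta_reduce; rw [h₂, mul_pow, one_mul], h₃⟩

lemma theta1_sq_mem {τ : ℂ} (hτ : 0 < τ.im) :
    (fun z ↦ theta1 z τ ^ 2) ∈ evenThetaSpace τ 1 2 :=
  sq_mem_evenThetaSpace (differentiable_theta1 hτ) (fun z ↦ by rw [theta1_add_pi _ hτ, neg_sq])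
    (fun z ↦ by rw [theta1_add_tau _ hτ, neg_mul, neg_sq])
    (fun z ↦ by rw [theta1_neg _ hτ, neg_sq])

lemma theta2_sq_mem {τ : ℂ} (hτ : 0 < τ.im) :
    (fun z ↦ theta2 z τ ^ 2) ∈ evenThetaSpace τ 1 2 :=
  sq_mem_evenThetaSpace (differentiable_theta2 hτ) (fun z ↦ by rw [theta2_add_pi _ hτ, neg_sq])
    (fun z ↦ by rw [theta2_add_tau _ hτ]) (fun z ↦ by rw [theta2_neg])

lemma theta3_sq_mem {τ : ℂ} (hτ : 0 < τ.im) :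
    (fun z ↦ theta3 z τ ^ 2) ∈ evenThetaSpace τ 1 2 :=
  sq_mem_evenThetaSpace (differentiable_theta3 hτ) (fun z ↦ by rw [theta3_add_pi _ hτ])
    (fun z ↦ by rw [theta3_add_tau _ hτ]) (fun z ↦ by rw [theta3_neg])

lemma theta4_sq_mem {τ : ℂ} (hτ : 0 < τ.im) :
    (fun z ↦ theta4 z τ ^ 2) ∈ evenThetaSpace τ 1 2 :=
  sq_mem_evenThetaSpace (differentiable_theta4 hτ) (fun z ↦ by rw [theta4_add_pi _ hτ])
    (fun z ↦ by rw [theta4_add_tau _ hτ, neg_mul, neg_sq]) (fun z ↦ by rw [theta4_neg])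

lemma mul_mul_mul_mem_evenThetaSpace {τ : ℂ} {a b c d : ℂ → ℂ} (ha : a ∈ evenThetaSpace τ 1 2)
    (hb : b ∈ evenThetaSpace τ 1 2) (hc : c ∈ evenThetaSpace τ 1 2)
    (hd : d ∈ evenThetaSpace τ 1 2) : a * b * c * d ∈ evenThetaSpace τ 1 8 := by
  simpa only [Nat.reduceAdd, one_mul, mul_one] using
    mul_mem_evenThetaSpace (mul_mem_evenThetaSpace (mul_mem_evenThetaSpace ha hb) hc) hd

/-- The partial fraction expansion with denominators cleared. -/
lemma mul_eq_of_mem_evenThetaSpace_eight {τ : ℂ} (hτ : 0 < τ.im) {f : ℂ → ℂ}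
    (hf : f ∈ evenThetaSpace τ 1 8) {y : ℂ} (h₂ : theta2 0 τ ≠ 0) (h₃ : theta3 0 τ ≠ 0)
    (h₄ : theta4 0 τ ≠ 0) (hy₁ : theta1 y τ ≠ 0) (hy₂ : theta2 y τ ≠ 0) (hy₃ : theta3 y τ ≠ 0)
    (hy₄ : theta4 y τ ≠ 0) (x : ℂ) :
    (theta2 0 τ * theta3 0 τ * theta4 0 τ) ^ 2 * f x =
      (theta2 0 τ * theta3 0 τ * theta4 0 τ) ^ 2 * f y /
          (theta1 y τ * theta2 y τ * theta3 y τ * theta4 y τ) ^ 2 *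
        (theta1 x τ ^ 2 * theta2 x τ ^ 2 * theta3 x τ ^ 2 * theta4 x τ ^ 2) +
      theta1 (x + y) τ * theta1 (x - y) τ *
        (-(f 0) / theta1 y τ ^ 2 * (theta2 x τ ^ 2 * theta3 x τ ^ 2 * theta4 x τ ^ 2)
          + f (piC / 2) / theta2 y τ ^ 2 * (theta1 x τ ^ 2 * theta3 x τ ^ 2 * theta4 x τ ^ 2)
          - qq τ * f ((piC + piC * τ) / 2) / theta3 y τ ^ 2 *
            (theta1 x τ ^ 2 * theta2 x τ ^ 2 * theta4 x τ ^ 2)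
          + qq τ * f (piC * τ / 2) / theta4 y τ ^ 2 *
            (theta1 x τ ^ 2 * theta2 x τ ^ 2 * theta3 x τ ^ 2)) := by
  set C := theta2 0 τ * theta3 0 τ * theta4 0 τ with hC
  set K := C ^ 2 * f y / (theta1 y τ * theta2 y τ * theta3 y τ * theta4 y τ) ^ 2 with hK
  have m := theta1_mul_theta1_mem hτ y
  have m₁ := theta1_sq_mem hτ
  have m₂ := theta2_sq_mem hτ
  have m₃ := theta3_sq_mem hτ
  have m₄ := theta4_sq_mem hτ
  have hmem := sub_mem (sub_mem (Submodule.smul_mem _ (C ^ 2) hf)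
    (Submodule.smul_mem _ K (mul_mul_mul_mem_evenThetaSpace m₁ m₂ m₃ m₄)))
    (add_mem (sub_mem (add_mem
      (Submodule.smul_mem _ (-(f 0) / theta1 y τ ^ 2)
        (mul_mul_mul_mem_evenThetaSpace m m₂ m₃ m₄))
      (Submodule.smul_mem _ (f (piC / 2) / theta2 y τ ^ 2)
        (mul_mul_mul_mem_evenThetaSpace m m₁ m₃ m₄)))
      (Submodule.smul_mem _ (qq τ * f ((piC + piC * τ) / 2) / theta3 y τ ^ 2)
        (mul_mul_mul_mem_evenThetaSpace m m₁ m₂ m₄)))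
      (Submodule.smul_mem _ (qq τ * f (piC * τ / 2) / theta4 y τ ^ 2)
        (mul_mul_mul_mem_evenThetaSpace m m₁ m₂ m₃)))
  have hswap (p : ℂ) : theta1 (p + y) τ * theta1 (p - y) τ =
      -(theta1 (y + p) τ * theta1 (y - p) τ) := by
    rw [add_comm, ← neg_sub y p, theta1_neg _ hτ, mul_neg]
  have hq := qq_mul_halfShiftFactor_pow τ
  have hzero := eq_zero_of_mem_evenThetaSpace_eight_of_eval hτ
    ![0, piC / 2, (piC + piC * τ) / 2, piC * τ / 2, y]
    (theta1_mul_theta1_ne_zero hτ h₂ h₃ h₄ hy₁ hy₂ hy₃ hy₄) hmem ?_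
  · have hx := congrFun hzero x
    simp only [Pi.add_apply, Pi.sub_apply, Pi.smul_apply, Pi.mul_apply, smul_eq_mul,
      Pi.zero_apply] at hx
    linear_combination hx
  · intro i
    fin_cases i
    · simp [theta1_zero hτ, theta1_neg _ hτ]
      field_simp
      rw [hC]
      ring
    · simp [theta2_half hτ, hswap, theta1_mul_theta1_half _ hτ, theta1_half hτ, theta3_half hτ,
        theta4_half hτ]
      field_simp
      rw [hC]
      ring
    · simp [hswap, theta1_mul_theta1_half_add_half_tau _ hτ, theta1_half_add_half_tau hτ,
        theta2_half_add_half_tau hτ, theta3_half_add_half_tau hτ, theta4_half_add_half_tau hτ,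
        mul_pow]
      generalize f ((piC + piC * τ) / 2) = a
      field_simp
      rw [hC]
      linear_combination (-a *
        (theta2 0 τ * theta3 0 τ * theta4 0 τ) ^ 2) * hq
    · simp [hswap, theta1_mul_theta1_half_tau _ hτ, theta1_half_tau hτ,
        theta2_half_tau hτ, theta3_half_tau hτ, theta4_half_tau hτ, mul_pow]
      field_simp
      rw [hC]
      linear_combination (-f (piC * τ / 2) *
        (theta2 0 τ * theta3 0 τ * theta4 0 τ) ^ 2) * hq
    · simp [theta1_zero hτ, hK]
      field_simp
      ring

theorem statement0 (τ : ℂ) (hτ : 0 < τ.im) (f : ℂ → ℂ)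
    (hf : Differentiable ℂ f)
    (heven : ∀ z : ℂ, f (-z) = f z)
    (hper1 : ∀ z : ℂ, f z = f (z + piC))
    (hper2 : ∀ z : ℂ, f z = qq τ ^ 4 * exp (16 * I * z) * f (z + piC * τ))
    (x y : ℂ)
    (h1x : theta1 (2 * x) τ ≠ 0) (h1y : theta1 (2 * y) τ ≠ 0)
    (h2x : theta1 x τ ≠ 0) (h2y : theta1 y τ ≠ 0)
    (h3x : theta2 x τ ≠ 0) (h3y : theta2 y τ ≠ 0)
    (h4x : theta3 x τ ≠ 0) (h4y : theta3 y τ ≠ 0)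
    (h5x : theta4 x τ ≠ 0) (h5y : theta4 y τ ≠ 0) :
    4 * f x / theta1 (2 * x) τ ^ 2 - 4 * f y / theta1 (2 * y) τ ^ 2 =
      theta1 (x + y) τ * theta1 (x - y) τ *
        (-(f 0) / (theta1 x τ ^ 2 * theta1 y τ ^ 2)
          + f (piC / 2) / (theta2 x τ ^ 2 * theta2 y τ ^ 2)
          - qq τ * f ((piC + piC * τ) / 2) / (theta3 x τ ^ 2 * theta3 y τ ^ 2)
          + qq τ * f (piC * τ / 2) / (theta4 x τ ^ 2 * theta4 y τ ^ 2)) := by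
  have hq (z : ℂ) : 1 * shiftFactor z τ ^ 8 * (qq τ ^ 4 * exp (16 * I * z)) = 1 := by
    rw [qq, shiftFactor, one_mul, ← exp_nat_mul, ← exp_nat_mul, ← exp_add, ← exp_add, ← exp_zero]
    push_cast
    ring_nf
  have hmem : f ∈ evenThetaSpace τ 1 8 := by
    refine ⟨hf, fun z ↦ (hper1 z).symm, fun z ↦ ?_, heven⟩
    rw [hper2 z, ← mul_assoc, hq, one_mul]
  have hdx := theta1_two_mul hτ x
  have hdy := theta1_two_mul hτ y
  have hC : theta2 0 τ * theta3 0 τ * theta4 0 τ ≠ 0 := by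
    refine left_ne_zero_of_mul (b := theta1 (2 * x) τ) ?_
    rw [hdx]
    simp [h2x, h3x, h4x, h5x]
  have hinv (z : ℂ) (hz : theta1 (2 * z) τ ≠ 0) : 4 * f z / theta1 (2 * z) τ ^ 2 =
      (theta2 0 τ * theta3 0 τ * theta4 0 τ) ^ 2 * f z /
        (theta1 z τ * theta2 z τ * theta3 z τ * theta4 z τ) ^ 2 := by
    have hd := theta1_two_mul hτ z
    have hne : theta1 z τ * theta2 z τ * theta3 z τ * theta4 z τ ≠ 0 := fun h0 ↦
      mul_ne_zero hC hz (by linear_combination hd + 2 * h0)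
    rw [div_eq_div_iff (pow_ne_zero 2 hz) (pow_ne_zero 2 hne)]
    linear_combination (-f z * (theta2 0 τ * theta3 0 τ * theta4 0 τ * theta1 (2 * z) τ +
      2 * theta1 z τ * theta2 z τ * theta3 z τ * theta4 z τ)) * hd
  have h := mul_eq_of_mem_evenThetaSpace_eight hτ hmem
    (left_ne_zero_of_mul (left_ne_zero_of_mul hC)) (right_ne_zero_of_mul (left_ne_zero_of_mul hC))
    (right_ne_zero_of_mul hC) h2y h3y h4y h5y x
  rw [hinv x h1x, h, hinv y h1y]
  field_simp
  ring

end Liu
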